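/- For every positive integer D and every r > 0, the entire function ζ ↦ w_D(ζ, r) is a Laguerre entire function of the first kind with a genus-zero Hadamard product over negative real zeros: there exists a summable sequence (γ_j) of nonnegative real numbers such that w_D(ζ, r) = w_D(0, r) · ∏_{j=1}^∞ (1 + γ_j ζ) for all ζ ∈ ℂ, where w_D(0, r) = r^{D/2−1}/Γ(D/2) > 0. In particular, every zero of ζ ↦ w_D(ζ, r) is a negative real number. -/

import Mathlib

noncomputable section

/-- The kernel `w_D(ζ, r) = Σ_{n≥0} ζⁿ r^{D/2+n−1} / (4ⁿ n! Γ(D/2+n))`. -/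
def wD (D : ℕ) (ζ : ℂ) (r : ℝ) : ℂ :=
  ∑' n : ℕ, ζ ^ n *
    ((r ^ ((D : ℝ) / 2 + n - 1) / (4 ^ n * n.factorial * Real.Gamma ((D : ℝ) / 2 + n)) : ℝ) : ℂ)

open Polynomial Filter Topology Finset

/-- The polynomial `∑ₖ (N choose k) Γ(a) / Γ(a + k) Xᵏ`, a rescaled Laguerre polynomial,
defined through the recurrence that exhibits its zeros. -/
def scaledLaguerre (a : ℝ) : ℕ → ℂ[X]
  | 0 => 1
  | N + 1 => C (((a + N)⁻¹ : ℝ) : ℂ) *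
      ((C ((a + N : ℝ) : ℂ) + X) * scaledLaguerre a N + X * derivative (scaledLaguerre a N))

lemma Gamma_div_Gamma_add_pos {a : ℝ} (ha : 0 < a) (k : ℕ) :
    0 < Real.Gamma a / Real.Gamma (a + k) :=
  div_pos (Real.Gamma_pos_of_pos ha) (Real.Gamma_pos_of_pos (by positivity))

lemma Gamma_div_Gamma_add_succ {a : ℝ} (ha : 0 < a) (k : ℕ) :
    Real.Gamma a / Real.Gamma (a + (k + 1 : ℕ)) =
      Real.Gamma a / Real.Gamma (a + k) / (a + k) := by
  have h : 0 < a + k := by positivity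
  rw [Nat.cast_succ, ← add_assoc, Real.Gamma_add_one h.ne', div_div, mul_comm (a + k)]

lemma coeff_scaledLaguerre {a : ℝ} (ha : 0 < a) (N k : ℕ) :
    (scaledLaguerre a N).coeff k =
      ((N.choose k * (Real.Gamma a / Real.Gamma (a + k)) : ℝ) : ℂ) := by
  have hG : Real.Gamma a ≠ 0 := (Real.Gamma_pos_of_pos ha).ne'
  induction N generalizing k with
  | zero =>
    rcases k with - | k
    · simp [scaledLaguerre, hG]
    · simp [scaledLaguerre, coeff_one]
  | succ N ih =>
    have hN : a + N ≠ 0 := by positivity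
    rcases k with - | k
    · rw [scaledLaguerre, coeff_C_mul, add_mul, coeff_add, coeff_add, coeff_C_mul, ih]
      simp only [mul_coeff_zero, coeff_X_zero, zero_mul, add_zero]
      norm_cast
      simp [hG, hN]
    · rw [scaledLaguerre, coeff_C_mul, add_mul, coeff_add, coeff_add, coeff_C_mul, coeff_X_mul,
        coeff_X_mul, coeff_derivative, ih, ih, Gamma_div_Gamma_add_succ ha k]
      norm_cast
      have hk : a + k ≠ 0 := by positivity
      have hch : ((N.choose (k + 1) : ℕ) : ℝ) * (k + 1) = N.choose k * (N - k) := by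
        rcases le_or_gt k N with h | h
        · have := Nat.choose_succ_right_eq N k
          rw [← Nat.cast_sub h]
          exact_mod_cast this
        · simp [Nat.choose_eq_zero_of_lt h, Nat.choose_eq_zero_of_lt (h.trans (Nat.lt_succ_self k))]
      rw [Nat.choose_succ_succ, inv_mul_eq_iff_eq_mul₀ hN]
      push_cast
      field_simp
      linear_combination hch

lemma eval_scaledLaguerre {a : ℝ} (ha : 0 < a) (N : ℕ) (z : ℂ) :
    (scaledLaguerre a N).eval z =
      ∑ k ∈ range (N + 1), ((N.choose k * (Real.Gamma a / Real.Gamma (a + k)) : ℝ) : ℂ) * z ^ k := by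
  have hdeg : (scaledLaguerre a N).natDegree < N + 1 := by
    rw [Nat.lt_succ_iff, natDegree_le_iff_coeff_eq_zero]
    intro k hk
    simp [coeff_scaledLaguerre ha, Nat.choose_eq_zero_of_lt hk]
  rw [eval_eq_sum_range' hdeg]
  exact sum_congr rfl fun k _ => by rw [coeff_scaledLaguerre ha]

lemma eval_zero_scaledLaguerre {a : ℝ} (ha : 0 < a) (N : ℕ) :
    (scaledLaguerre a N).eval 0 = 1 := by
  rw [← coeff_zero_eq_eval_zero, coeff_scaledLaguerre ha]
  simp [(Real.Gamma_pos_of_pos ha).ne']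

lemma eval_ofReal_scaledLaguerre_ne_zero {a : ℝ} (ha : 0 < a) (N : ℕ) {t : ℝ} (ht : 0 ≤ t) :
    (scaledLaguerre a N).eval (t : ℂ) ≠ 0 := by
  rw [eval_scaledLaguerre ha]
  norm_cast
  have hG := Gamma_div_Gamma_add_pos ha
  refine (sum_pos' (fun k _ => ?_) ⟨0, by simp, ?_⟩).ne'
  · have := hG k
    positivity
  · simpa using hG 0

/-- The logarithmic derivative of a polynomial with real zeros maps the upper half-plane
to the lower one, and conversely. -/
lemma im_mul_im_sum_one_div_nonpos (s : Multiset ℂ) (hs : ∀ ρ ∈ s, ρ.im = 0) (z : ℂ) :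
    z.im * ((s.map fun ρ => 1 / (z - ρ)).sum).im ≤ 0 := by
  induction s using Multiset.induction_on with
  | empty => simp
  | cons ρ s ih =>
    have h1 := ih fun σ hσ => hs σ (Multiset.mem_cons_of_mem hσ)
    have h2 : z.im * (1 / (z - ρ)).im ≤ 0 := by
      rw [one_div, Complex.inv_im, Complex.sub_im, hs ρ (Multiset.mem_cons_self ρ s), sub_zero,
        mul_div_assoc']
      exact div_nonpos_of_nonpos_of_nonneg (by nlinarith [sq_nonneg z.im]) (Complex.normSq_nonneg _)
    rw [Multiset.map_cons, Multiset.sum_cons, Complex.add_im, mul_add]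
    exact add_nonpos h2 h1

lemma im_eq_zero_of_eval_scaledLaguerre_eq_zero {a : ℝ} (ha : 0 < a) (N : ℕ) {z : ℂ}
    (hz : (scaledLaguerre a N).eval z = 0) : z.im = 0 := by
  induction N generalizing z with
  | zero => simp [scaledLaguerre] at hz
  | succ N ih =>
    by_cases hQ : (scaledLaguerre a N).eval z = 0
    · exact ih hQ
    have haN : 0 < a + N := by positivity
    have hz0 : z ≠ 0 := by
      rintro rfl
      simp [eval_zero_scaledLaguerre ha] at hz
    have hlog := (IsAlgClosed.splits (scaledLaguerre a N)).eval_derivative_div_eval_of_ne_zero hQ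
    have hroots : ∀ ρ ∈ (scaledLaguerre a N).roots, ρ.im = 0 := fun ρ hρ =>
      ih (isRoot_of_mem_roots hρ)
    have hnonpos := im_mul_im_sum_one_div_nonpos _ hroots z
    rw [← hlog] at hnonpos
    set q := (derivative (scaledLaguerre a N)).eval z / (scaledLaguerre a N).eval z with hq
    have hsum : ((a + N : ℝ) : ℂ) * z⁻¹ + 1 + q = 0 := by
      rw [scaledLaguerre, eval_mul, eval_C, mul_eq_zero] at hz
      have h := hz.resolve_left (by exact_mod_cast (inv_pos.2 haN).ne')
      simp only [eval_add, eval_mul, eval_C, eval_X] at h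
      rw [hq]
      field_simp
      linear_combination h
    have him := congrArg Complex.im hsum
    rw [Complex.add_im, Complex.add_im, Complex.im_ofReal_mul, Complex.one_im, Complex.zero_im,
      add_zero, Complex.inv_im] at him
    by_contra hne
    have hpos : 0 < (a + N) * (z.im ^ 2 / Complex.normSq z) :=
      mul_pos haN (div_pos (by positivity) (Complex.normSq_pos.2 hz0))
    have : z.im * q.im = (a + N) * (z.im ^ 2 / Complex.normSq z) := by
      linear_combination z.im * him
    linarith

lemma exists_neg_of_eval_scaledLaguerre_eq_zero {a : ℝ} (ha : 0 < a) (N : ℕ) {z : ℂ}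
    (hz : (scaledLaguerre a N).eval z = 0) : ∃ t : ℝ, t < 0 ∧ z = t := by
  have h : z = (z.re : ℂ) :=
    Complex.ext rfl (im_eq_zero_of_eval_scaledLaguerre_eq_zero ha N hz)
  refine ⟨z.re, ?_, h⟩
  by_contra! hre
  exact eval_ofReal_scaledLaguerre_ne_zero ha N hre (h ▸ hz)

lemma List.prod_range_getD {M : Type*} [CommMonoid M] (l : List ℝ) (f : ℝ → M) (hf : f 0 = 1)
    {m : ℕ} (hm : l.length ≤ m) :
    ∏ k ∈ Finset.range m, f (l.getD k 0) = (l.map f).prod := by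
  induction l generalizing m with
  | nil => simp [hf]
  | cons x l ih =>
    obtain ⟨m, rfl⟩ : ∃ j, m = j + 1 := ⟨m - 1, by simp at hm; omega⟩
    rw [Finset.prod_range_succ']
    simp only [List.getD_cons_succ, List.getD_cons_zero, List.map_cons, List.prod_cons]
    rw [ih (by simpa using hm), mul_comm]

lemma Multiset.exists_antitone_prod (s : Multiset ℝ) (hs : ∀ x ∈ s, 0 ≤ x) :
    ∃ γ : ℕ → ℝ, Antitone γ ∧ (∀ k, 0 ≤ γ k) ∧
      ∀ (f : ℝ → ℂ), f 0 = 1 → ∀ m, Multiset.card s ≤ m →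
        ∏ k ∈ Finset.range m, f (γ k) = (s.map f).prod := by
  set l := s.sort (· ≥ ·)
  have hls : (l : Multiset ℝ) = s := Multiset.sort_eq s _
  have h0 : ∀ k, 0 ≤ l.getD k 0 := by
    intro k
    rcases lt_or_ge k l.length with h | h
    · rw [List.getD_eq_getElem _ _ h]
      exact hs _ (by rw [← hls]; exact Multiset.mem_coe.2 (List.getElem_mem h))
    · rw [List.getD_eq_default _ _ h]
  have hsorted : l.Pairwise (· ≥ ·) := Multiset.pairwise_sort s _
  refine ⟨fun k => l.getD k 0, fun i j hij => ?_, h0, fun f hf m hm => ?_⟩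
  · rcases lt_or_ge j l.length with h | h
    · simp only [List.getD_eq_getElem _ _ h, List.getD_eq_getElem _ _ (hij.trans_lt h)]
      exact hsorted.rel_get_of_le (a := ⟨i, hij.trans_lt h⟩) (b := ⟨j, h⟩) hij
    · simp only [List.getD_eq_default _ _ h]
      exact h0 i
  · rw [List.prod_range_getD l f hf (by rw [← hls] at hm; simpa using hm), ← hls]
    simp

lemma exists_prod_eq_scaledLaguerre {a : ℝ} (ha : 0 < a) (N : ℕ) :
    ∃ γ : ℕ → ℝ, Antitone γ ∧ (∀ k, 0 ≤ γ k) ∧ ∃ m₀, ∀ m, m₀ ≤ m → ∀ z : ℂ,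
      ∏ k ∈ range m, (1 + (γ k : ℂ) * z) = (scaledLaguerre a N).eval z := by
  set Q := scaledLaguerre a N
  have hneg : ∀ ρ ∈ Q.roots, ∃ t : ℝ, t < 0 ∧ ρ = t := fun ρ hρ =>
    exists_neg_of_eval_scaledLaguerre_eq_zero ha N (isRoot_of_mem_roots hρ)
  obtain ⟨γ, hanti, hnonneg, hprod⟩ :=
    Multiset.exists_antitone_prod (Q.roots.map fun ρ => -ρ.re⁻¹) (by
      intro x hx
      obtain ⟨ρ, hρ, rfl⟩ := Multiset.mem_map.1 hx
      obtain ⟨t, ht, rfl⟩ := hneg ρ hρ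
      simpa using (inv_lt_zero.2 ht).le)
  refine ⟨γ, hanti, hnonneg, Multiset.card (Q.roots.map fun ρ => -ρ.re⁻¹), fun m hm z => ?_⟩
  rw [hprod (fun x => 1 + (x : ℂ) * z) (by simp) m hm, Multiset.map_map]
  have hsp : Q.Splits := IsAlgClosed.splits Q
  have hlead : Q.leadingCoeff * (Q.roots.map fun ρ => -ρ).prod = 1 := by
    have := hsp.eval_eq_prod_roots 0
    rw [eval_zero_scaledLaguerre ha] at this
    simpa using this.symm
  rw [hsp.eval_eq_prod_roots z]
  have hfac : Q.roots.map (fun ρ => z - ρ) =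
      Q.roots.map fun ρ => -ρ * (1 + ((-ρ.re⁻¹ : ℝ) : ℂ) * z) := by
    refine Multiset.map_congr rfl fun ρ hρ => ?_
    obtain ⟨t, ht, rfl⟩ := hneg ρ hρ
    have : (t : ℂ) ≠ 0 := by exact_mod_cast ht.ne
    simp only [Complex.ofReal_re]
    push_cast
    field_simp
    ring
  rw [hfac, Multiset.prod_map_mul, ← mul_assoc, hlead, one_mul]
  rfl

lemma Gamma_div_Gamma_add_le {a : ℝ} (ha : 1 / 2 ≤ a) (k : ℕ) :
    Real.Gamma a / Real.Gamma (a + k) ≤ 4 ^ k * k.factorial / (2 * k).factorial := by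
  have ha0 : 0 < a := by linarith
  induction k with
  | zero => simp [(Real.Gamma_pos_of_pos ha0).ne']
  | succ k ih =>
    rw [Gamma_div_Gamma_add_succ ha0]
    calc _ ≤ (4 ^ k * k.factorial / (2 * k).factorial / (1 / 2 + k) : ℝ) := by gcongr
      _ = _ := by
        rw [show 2 * (k + 1) = 2 * k + 1 + 1 by ring, Nat.factorial_succ (2 * k + 1),
          Nat.factorial_succ (2 * k), Nat.factorial_succ k]
        push_cast
        field_simp
        ring

lemma Gamma_div_Gamma_add_div_factorial_mul_pow_le {a : ℝ} (ha : 1 / 2 ≤ a) {y : ℝ} (k : ℕ) :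
    Real.Gamma a / Real.Gamma (a + k) / k.factorial * (y ^ 2 / 4) ^ k ≤
      y ^ (2 * k) / (2 * k).factorial := by
  have hy : 0 ≤ (y ^ 2 / 4) ^ k := by positivity
  calc _ ≤ 4 ^ k * k.factorial / (2 * k).factorial / k.factorial * (y ^ 2 / 4) ^ k := by
        exact mul_le_mul_of_nonneg_right
          (div_le_div_of_nonneg_right (Gamma_div_Gamma_add_le ha k) (by positivity)) hy
    _ = _ := by
        rw [div_pow, ← pow_mul]
        field_simp

lemma choose_div_pow_le (N k : ℕ) : (N.choose k : ℝ) / N ^ k ≤ 1 / k.factorial := by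
  rcases eq_or_ne ((N : ℝ) ^ k) 0 with h | h
  · rw [h, div_zero]
    positivity
  · rw [div_le_iff₀ (by positivity), one_div_mul_eq_div]
    exact Nat.choose_le_pow_div k N

lemma scaledLaguerre_bound {a : ℝ} (ha : 1 / 2 ≤ a) (N : ℕ) {y : ℝ} (hy : 0 ≤ y) :
    ∑ k ∈ range (N + 1), N.choose k * (Real.Gamma a / Real.Gamma (a + k)) * (y ^ 2 / 4 / N) ^ k ≤
      Real.exp y := by
  have ha0 : 0 < a := by linarith
  calc _ ≤ ∑ k ∈ range (N + 1), y ^ (2 * k) / (2 * k).factorial := by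
        refine sum_le_sum fun k _ => le_trans ?_ (Gamma_div_Gamma_add_div_factorial_mul_pow_le ha k)
        have hG := (Gamma_div_Gamma_add_pos ha0 k).le
        have h := mul_le_mul_of_nonneg_left (choose_div_pow_le N k)
          (mul_nonneg hG (by positivity : 0 ≤ (y ^ 2 / 4) ^ k))
        calc _ = Real.Gamma a / Real.Gamma (a + k) * (y ^ 2 / 4) ^ k * (N.choose k / N ^ k) := by
              rw [div_pow _ (N : ℝ)]; ring
          _ ≤ _ := h
          _ = _ := by ring
    _ ≤ Real.cosh y := sum_le_hasSum _ (fun k _ => by positivity) (Real.hasSum_cosh y)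
    _ ≤ Real.exp y := by
        rw [Real.cosh_eq]
        have : Real.exp (-y) ≤ Real.exp y := Real.exp_le_exp.2 (by linarith)
        linarith

lemma summable_div_nat_add_one_sq (c : ℝ) : Summable fun k : ℕ => c / ((k : ℝ) + 1) ^ 2 := by
  have h := (summable_nat_add_iff 1).2 (Real.summable_one_div_nat_pow.2 one_lt_two)
  simpa [div_eq_mul_inv] using h.mul_left c

/-- The product factorization of `z ↦ scaledLaguerre a N (z / N)`, with parameters
bounded uniformly in `N`. -/
lemma exists_tprod_eq_scaledLaguerre {a : ℝ} (ha : 1 / 2 ≤ a) (N : ℕ) :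
    ∃ γ : ℕ → ℝ, (∀ k : ℕ, γ k ∈ Set.Icc 0 ((Real.exp 2 - 1) / ((k : ℝ) + 1) ^ 2)) ∧
      ∀ z : ℂ, ∏' k, (1 + (γ k : ℂ) * z) = (scaledLaguerre a N).eval (z / N) := by
  have ha0 : 0 < a := by linarith
  obtain ⟨γ, hanti, hnonneg, m₀, hprod⟩ := exists_prod_eq_scaledLaguerre ha0 N
  have hsum := summable_div_nat_add_one_sq (Real.exp 2 - 1)
  have hmem : ∀ k : ℕ, γ k / N ∈ Set.Icc 0 ((Real.exp 2 - 1) / ((k : ℝ) + 1) ^ 2) := fun k => by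
    refine ⟨by have := hnonneg k; positivity, ?_⟩
    set x : ℝ := (2 * ((k : ℝ) + 1)) ^ 2 / 4 / N with hx
    have hx0 : 0 ≤ x := by positivity
    have hprod' : ∏ i ∈ range (max m₀ (k + 1)), (1 + γ i * x) ≤ Real.exp (2 * ((k : ℝ) + 1)) := by
      refine le_trans (le_of_eq ?_) (scaledLaguerre_bound ha N (by positivity))
      have h := hprod (max m₀ (k + 1)) (le_max_left _ _) x
      rw [eval_scaledLaguerre ha0] at h
      rw [← hx]
      exact_mod_cast h
    have hpow : (1 + γ k * x) ^ (k + 1) ≤ Real.exp 2 ^ (k + 1) := by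
      calc (1 + γ k * x) ^ (k + 1) = ∏ i ∈ range (k + 1), (1 + γ k * x) := by simp
        _ ≤ ∏ i ∈ range (k + 1), (1 + γ i * x) := by
            refine prod_le_prod (fun i _ => ?_) fun i hi => ?_
            · have := hnonneg k; positivity
            · have := hanti (Nat.lt_succ_iff.1 (mem_range.1 hi))
              gcongr
        _ ≤ ∏ i ∈ range (max m₀ (k + 1)), (1 + γ i * x) := by
            refine prod_le_prod_of_subset_of_one_le
              (range_subset_range.2 (le_max_right _ _)) (fun i _ => ?_) fun i _ _ => ?_
            all_goals
              have := mul_nonneg (hnonneg i) hx0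
              linarith
        _ ≤ _ := hprod'
        _ = _ := by rw [← Real.exp_nat_mul]; push_cast; ring_nf
    have hle : 1 + γ k * x ≤ Real.exp 2 :=
      le_of_pow_le_pow_left₀ k.succ_ne_zero (Real.exp_pos 2).le hpow
    have hxe : γ k * x = γ k / N * ((k : ℝ) + 1) ^ 2 := by rw [hx]; ring
    rw [le_div_iff₀ (by positivity), ← hxe]
    linarith
  refine ⟨fun k => γ k / N, hmem, fun z => ?_⟩
  have hmult : Multipliable fun k => 1 + ((γ k / N : ℝ) : ℂ) * z := by
    refine multipliable_one_add_of_summable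
      ((hsum.mul_right ‖z‖).of_nonneg_of_le (fun k => norm_nonneg _) fun k => ?_)
    rw [norm_mul, Complex.norm_real, Real.norm_of_nonneg (hmem k).1]
    exact mul_le_mul_of_nonneg_right (hmem k).2 (norm_nonneg z)
  refine tendsto_nhds_unique hmult.hasProd.tendsto_prod_nat
    (tendsto_const_nhds.congr' ?_)
  filter_upwards [eventually_ge_atTop m₀] with m hm
  rw [← hprod m hm]
  refine prod_congr rfl fun k _ => ?_
  push_cast
  ring

lemma tendsto_eval_scaledLaguerre {a : ℝ} (ha : 1 / 2 ≤ a) (z : ℂ) :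
    Tendsto (fun N : ℕ => (scaledLaguerre a N).eval (z / N)) atTop
      (𝓝 (∑' k : ℕ, ((Real.Gamma a / Real.Gamma (a + k) / k.factorial : ℝ) : ℂ) * z ^ k)) := by
  have ha0 : 0 < a := by linarith
  have heq : ∀ N : ℕ, (scaledLaguerre a N).eval (z / N) =
      ∑' k : ℕ, ((N.choose k / N ^ k * (Real.Gamma a / Real.Gamma (a + k)) : ℝ) : ℂ) * z ^ k := by
    intro N
    rw [eval_scaledLaguerre ha0, tsum_eq_sum (s := range (N + 1))]
    · refine sum_congr rfl fun k _ => ?_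
      push_cast
      rw [div_pow]
      ring
    · intro k hk
      simp [Nat.choose_eq_zero_of_lt (by simpa using hk : N < k)]
  simp_rw [heq]
  set y : ℝ := 2 * √‖z‖
  have hy : y ^ 2 / 4 = ‖z‖ := by
    rw [mul_pow, Real.sq_sqrt (norm_nonneg z)]
    ring
  refine tendsto_tsum_of_dominated_convergence (Real.hasSum_cosh y).summable (fun k => ?_)
    (Eventually.of_forall fun N k => ?_)
  · have h : Tendsto (fun N : ℕ => (N.choose k : ℝ) / N ^ k) atTop (𝓝 (1 / k.factorial)) := by
      have h1 := ProbabilityTheory.tendsto_choose_mul_pow_atTop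
        (p := fun N : ℕ => (N : ℝ)⁻¹) (r := 1) (k := k) (by
        refine tendsto_const_nhds.congr' ?_
        filter_upwards [eventually_ne_atTop 0] with N hN
        rw [mul_inv_cancel₀ (by exact_mod_cast hN)])
      simpa [div_eq_mul_inv] using h1
    have h2 := (h.mul_const (Real.Gamma a / Real.Gamma (a + k))).ofReal 
    rw [one_div_mul_eq_div] at h2
    exact h2.mul_const _
  · have hG := Gamma_div_Gamma_add_pos ha0 k
    rw [norm_mul, norm_pow, Complex.norm_real, Real.norm_of_nonneg (by positivity)]
    refine le_trans ?_ (Gamma_div_Gamma_add_div_factorial_mul_pow_le ha k)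
    rw [hy, div_eq_mul_one_div _ (k.factorial : ℝ), mul_comm _ (1 / (k.factorial : ℝ))]
    exact mul_le_mul_of_nonneg_right
      (mul_le_mul_of_nonneg_right (choose_div_pow_le N k) hG.le) (by positivity)

/-- Laguerre's theorem for the normalized Bessel-type series `∑ₖ Γ(a) / (k! Γ(a + k)) zᵏ`. -/
theorem exists_tprod_eq_tsum_Gamma {a : ℝ} (ha : 1 / 2 ≤ a) :
    ∃ γ : ℕ → ℝ, (∀ j, 0 ≤ γ j) ∧ Summable γ ∧ ∀ z : ℂ,
      ∑' k : ℕ, ((Real.Gamma a / Real.Gamma (a + k) / k.factorial : ℝ) : ℂ) * z ^ k =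
        ∏' j, (1 + (γ j : ℂ) * z) := by
  choose γ hmem hprod using exists_tprod_eq_scaledLaguerre ha
  have hsum := summable_div_nat_add_one_sq (Real.exp 2 - 1)
  obtain ⟨δ, hδ, φ, hφ, hlim⟩ := (isCompact_univ_pi fun k : ℕ =>
    (isCompact_Icc : IsCompact (Set.Icc 0 ((Real.exp 2 - 1) / ((k : ℝ) + 1) ^ 2)))).tendsto_subseq
      (x := γ) fun N k _ => hmem N k
  have hδ' := fun k => hδ k (Set.mem_univ k)
  refine ⟨δ, fun j => (hδ' j).1, hsum.of_nonneg_of_le (fun j => (hδ' j).1) fun j => (hδ' j).2,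
    fun z => ?_⟩
  refine tendsto_nhds_unique ((tendsto_eval_scaledLaguerre ha z).comp hφ.tendsto_atTop) ?_
  have h := tendsto_tprod_one_add_of_dominated_convergence (𝓕 := atTop)
    (f := fun n k => (γ (φ n) k : ℂ) * z) (g := fun k => (δ k : ℂ) * z)
    (hsum.mul_right ‖z‖)
    (fun k => (((tendsto_pi_nhds.1 hlim k).ofReal ).mul_const z))
    (Eventually.of_forall fun n k => by
      rw [norm_mul, Complex.norm_real, Real.norm_of_nonneg (hmem _ k).1]
      exact mul_le_mul_of_nonneg_right (hmem _ k).2 (norm_nonneg z))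
  exact h.congr fun n => hprod _ z

lemma wD_eq_mul_tsum {D : ℕ} (hD : 0 < D) {r : ℝ} (hr : 0 < r) (ζ : ℂ) :
    wD D ζ r = ((r ^ ((D : ℝ) / 2 - 1) / Real.Gamma ((D : ℝ) / 2) : ℝ) : ℂ) *
      ∑' k : ℕ, ((Real.Gamma ((D : ℝ) / 2) / Real.Gamma ((D : ℝ) / 2 + k) / k.factorial : ℝ) : ℂ) *
        (((r / 4 : ℝ) : ℂ) * ζ) ^ k := by
  have hG : Real.Gamma ((D : ℝ) / 2) ≠ 0 := (Real.Gamma_pos_of_pos (by positivity)).ne'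
  rw [wD, ← tsum_mul_left]
  refine tsum_congr fun n => ?_
  have hr' : r ^ ((D : ℝ) / 2 + n - 1) = r ^ ((D : ℝ) / 2 - 1) * r ^ n := by
    rw [← Real.rpow_natCast, ← Real.rpow_add hr]
    ring_nf
  have hcoef : r ^ ((D : ℝ) / 2 + n - 1) /
      (4 ^ n * n.factorial * Real.Gamma ((D : ℝ) / 2 + n)) =
      r ^ ((D : ℝ) / 2 - 1) / Real.Gamma ((D : ℝ) / 2) *
        (Real.Gamma ((D : ℝ) / 2) / Real.Gamma ((D : ℝ) / 2 + n) / n.factorial) *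
          (r / 4) ^ n := by
    have hGn : Real.Gamma ((D : ℝ) / 2 + n) ≠ 0 := (Real.Gamma_pos_of_pos (by positivity)).ne'
    rw [hr', div_pow]
    field_simp
  rw [hcoef, mul_pow]
  push_cast
  ring

/-- **`w_D(·, r)` is a Laguerre entire function of the first kind** with genus-zero
Hadamard product over negative real zeros:
`w_D(ζ, r) = w_D(0, r) ∏_j (1 + γ_j ζ)` with `γ_j ≥ 0` summable and
`w_D(0, r) = r^{D/2−1}/Γ(D/2) > 0`; in particular, every zero of `w_D(·, r)` is a
negative real number. -/
theorem wD_laguerre (D : ℕ) (hD : 0 < D) (r : ℝ) (hr : 0 < r) :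
    (wD D 0 r = ((r ^ ((D : ℝ) / 2 - 1) / Real.Gamma ((D : ℝ) / 2) : ℝ) : ℂ)) ∧
    (0 < r ^ ((D : ℝ) / 2 - 1) / Real.Gamma ((D : ℝ) / 2)) ∧
    (∃ γ : ℕ → ℝ, (∀ j, 0 ≤ γ j) ∧ Summable γ ∧
      ∀ ζ : ℂ, wD D ζ r = wD D 0 r * ∏' j, (1 + (γ j : ℂ) * ζ)) ∧
    (∀ ζ : ℂ, wD D ζ r = 0 → ∃ t : ℝ, t < 0 ∧ ζ = (t : ℂ)) := by
  have hpos : 0 < r ^ ((D : ℝ) / 2 - 1) / Real.Gamma ((D : ℝ) / 2) :=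
    div_pos (Real.rpow_pos_of_pos hr _) (Real.Gamma_pos_of_pos (by positivity))
  have hhalf : 1 / 2 ≤ (D : ℝ) / 2 := by
    have : (1 : ℝ) ≤ D := by exact_mod_cast hD
    linarith
  obtain ⟨γ, hγ, hsum, hprod⟩ := exists_tprod_eq_tsum_Gamma hhalf
  have hwD : ∀ ζ : ℂ, wD D ζ r =
      ((r ^ ((D : ℝ) / 2 - 1) / Real.Gamma ((D : ℝ) / 2) : ℝ) : ℂ) *
        ∏' j, (1 + ((γ j * (r / 4) : ℝ) : ℂ) * ζ) := fun ζ => by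
    rw [wD_eq_mul_tsum hD hr, hprod]
    simp_rw [Complex.ofReal_mul, mul_assoc]
  have hzero : wD D 0 r = ((r ^ ((D : ℝ) / 2 - 1) / Real.Gamma ((D : ℝ) / 2) : ℝ) : ℂ) := by
    simp [hwD 0]
  have hsum' : Summable fun j => γ j * (r / 4) := hsum.mul_right _
  refine ⟨hzero, hpos, ⟨fun j => γ j * (r / 4), fun j => mul_nonneg (hγ j) (by positivity),
    hsum', fun ζ => by rw [hwD ζ, hzero]⟩, fun ζ hζ => ?_⟩
  rw [hwD ζ, mul_eq_zero] at hζ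
  have htp := hζ.resolve_left (by exact_mod_cast hpos.ne')
  obtain ⟨j, hj⟩ : ∃ j, 1 + ((γ j * (r / 4) : ℝ) : ℂ) * ζ = 0 := by
    by_contra! hne
    refine tprod_one_add_ne_zero_of_summable hne ?_ htp
    simp_rw [norm_mul, Complex.norm_real]
    exact hsum'.norm.mul_right _
  set c := γ j * (r / 4)
  have hc0 : c ≠ 0 := by
    intro hc
    simp [hc] at hj
  have hc : 0 < c := lt_of_le_of_ne (mul_nonneg (hγ j) (by positivity)) hc0.symm
  refine ⟨-c⁻¹, neg_lt_zero.2 (inv_pos.2 hc), ?_⟩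
  have hcC : (c : ℂ) ≠ 0 := by exact_mod_cast hc0
  push_cast
  field_simp
  linear_combination hj
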